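/- The grid graph P_m × P_n is neighborhood-prime if m ≡ 1 (mod 4) and n ≡ 1 (mod 4), or if m ≡ 3 (mod 4) and n ≡ 3 (mod 4). -/

import Mathlib

namespace SimpleGraph

open scoped Classical in
/-- A graph of order `n` is *neighborhood-prime* if there is a bijective labeling of the
vertices by `{1, …, n}` such that for every vertex of degree at least 2, the gcd of the
labels appearing in its neighborhood is 1. -/
noncomputable def IsNeighborhoodPrime {V : Type*} [Fintype V] (G : SimpleGraph V) : Prop :=
  ∃ f : V ≃ Fin (Fintype.card V),
    ∀ v : V, 2 ≤ G.degree v →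
      (G.neighborFinset v).gcd (fun u => (f u : ℕ) + 1) = 1

/-- The grid graph `P_m × P_n`: the Cartesian (box) product of the path on `m` vertices
with the path on `n` vertices. -/
def gridGraph (m n : ℕ) : SimpleGraph (Fin m × Fin n) :=
  (SimpleGraph.pathGraph m).boxProd (SimpleGraph.pathGraph n)

end SimpleGraph

namespace SimpleGraph

theorem IsNeighborhoodPrime.of_iso {V W : Type*} [Fintype V] [Fintype W] {G : SimpleGraph V}
    {H : SimpleGraph W} (φ : G ≃g H) (h : H.IsNeighborhoodPrime) : G.IsNeighborhoodPrime := by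
  classical
  obtain ⟨f, hf⟩ := h
  refine ⟨φ.toEquiv.trans (f.trans (finCongr (Fintype.card_congr φ.toEquiv).symm)), fun v hv => ?_⟩
  have hN : H.neighborFinset (φ v) = (G.neighborFinset v).map φ.toEquiv.toEmbedding := by
    ext w
    obtain ⟨u, rfl⟩ := φ.surjective w
    rw [mem_neighborFinset, φ.map_adj_iff]
    exact ((Finset.mem_map' φ.toEquiv.toEmbedding).trans (mem_neighborFinset ..)).symm
  have hdeg : 2 ≤ H.degree (φ v) := by
    rw [← card_neighborFinset_eq_degree] at hv ⊢
    convert hv using 1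
    convert Finset.card_map φ.toEquiv.toEmbedding using 2
  refine Eq.trans ?_ (hf (φ v) hdeg)
  trans ((G.neighborFinset v).map φ.toEquiv.toEmbedding).gcd (fun u => (f u : ℕ) + 1)
  · simp only [Finset.gcd_def, Finset.map_val, Multiset.map_map]
    rfl
  · congr 1
    convert hN.symm

/-- It suffices to label injectively by `{0, …, n - 1}` so that every vertex of degree at least two
has two neighbors whose shifted labels are coprime. -/
theorem isNeighborhoodPrime_of_coprime_pair {V : Type*} [Fintype V] {G : SimpleGraph V}
    (g : V → ℕ) (hlt : ∀ v, g v < Fintype.card V) (hinj : Function.Injective g)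
    (h : ∀ v u w, G.Adj v u → G.Adj v w → u ≠ w →
      ∃ x y, G.Adj v x ∧ G.Adj v y ∧ (g x + 1).Coprime (g y + 1)) :
    G.IsNeighborhoodPrime := by
  classical
  have hbij : Function.Bijective (fun v => (⟨g v, hlt v⟩ : Fin (Fintype.card V))) :=
    (Fintype.bijective_iff_injective_and_card _).2
      ⟨fun u v huv => hinj (Fin.mk.inj_iff.1 huv), (Fintype.card_fin _).symm⟩
  refine ⟨Equiv.ofBijective _ hbij, fun v hv => ?_⟩
  rw [← card_neighborFinset_eq_degree] at hv
  obtain ⟨u, hu, w, hw, huw⟩ := Finset.one_lt_card.1 hv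
  rw [mem_neighborFinset] at hu hw
  obtain ⟨x, y, hx, hy, hxy⟩ := h v u w hu hw huw
  exact Nat.eq_one_of_dvd_coprimes hxy
    (Finset.gcd_dvd ((mem_neighborFinset ..).2 hx))
    (Finset.gcd_dvd ((mem_neighborFinset ..).2 hy))

theorem gridGraph_adj {m n : ℕ} {u v : Fin m × Fin n} :
    (gridGraph m n).Adj u v ↔
      ((u.1 : ℕ) + 1 = v.1 ∨ (v.1 : ℕ) + 1 = u.1) ∧ (u.2 : ℕ) = v.2 ∨
      ((u.2 : ℕ) + 1 = v.2 ∨ (v.2 : ℕ) + 1 = u.2) ∧ (u.1 : ℕ) = v.1 := by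
  simp [gridGraph, boxProd_adj, pathGraph_adj, Fin.ext_iff]

end SimpleGraph

/-- The `i`-th vertex (from zero) of a cyclic order on `N` vertices, rotated by `s`. -/
def rotatedLabel (N s i : ℕ) : ℕ := if i < s then N - s + i else i - s

theorem rotatedLabel_lt {N s i : ℕ} (hs : s ≤ N) (hi : i < N) : rotatedLabel N s i < N := by
  unfold rotatedLabel; split_ifs <;> omega

theorem rotatedLabel_injOn {N s i j : ℕ} (hs : s ≤ N) (hi : i < N) (hj : j < N)
    (h : rotatedLabel N s i = rotatedLabel N s j) : i = j := by
  unfold rotatedLabel at h; split_ifs at h <;> omega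

theorem coprime_rotatedLabel_succ (N s i : ℕ) :
    (rotatedLabel N s i + 1).Coprime (rotatedLabel N s (i + 1) + 1) := by
  unfold rotatedLabel
  split_ifs with h₁ h₂ h₂
  · simp [← add_assoc]
  · rw [show i + 1 - s + 1 = 1 by omega]
    exact Nat.coprime_one_right _
  · omega
  · rw [show i + 1 - s = i - s + 1 by omega]
    simp

/-- Position of the vertex `(i, j)` of the `(2a+1) × (2b+1)` grid in the order that first snakes
through the vertices with `i + j` odd, then through those with `i + j` even, going down the even
columns and up the odd ones. -/
def snakeIndex (a b i j : ℕ) : ℕ :=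
  (if (i + j) % 2 = 1 then 0 else (2 * a + 1) * b + a) +
    ((2 * a + 1) * (j / 2) + if j % 2 = 0 then i / 2 else 2 * a - i / 2)

theorem snakeIndex_lt_iff {a b i j : ℕ} (hi : i < 2 * a + 1) (hj : j < 2 * b + 1) :
    snakeIndex a b i j < (2 * a + 1) * b + a ↔ (i + j) % 2 = 1 := by
  unfold snakeIndex
  by_cases h : (i + j) % 2 = 1
  · simp only [h, if_true, iff_true, zero_add]
    rcases (show j / 2 + 1 ≤ b ∨ j / 2 = b by omega) with hb | hb
    · have := Nat.mul_le_mul_left (2 * a + 1) hb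
      rw [mul_add] at this
      split_ifs <;> omega
    · rw [hb]; split_ifs <;> omega
  · simp only [h, if_false, iff_false]
    omega

theorem snakeIndex_lt {a b i j : ℕ} (hi : i < 2 * a + 1) (hj : j < 2 * b + 1) :
    snakeIndex a b i j < (2 * a + 1) * (2 * b + 1) := by
  have hN : (2 * a + 1) * (2 * b + 1) = 2 * ((2 * a + 1) * b + a) + 1 := by ring
  have h1 := snakeIndex_lt_iff hi hj
  by_cases h : (i + j) % 2 = 1
  · have := h1.2 h
    omega
  · unfold snakeIndex
    rw [if_neg h, hN]
    rcases (show j / 2 + 1 ≤ b ∨ j / 2 = b by omega) with hb | hb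
    · have := Nat.mul_le_mul_left (2 * a + 1) hb
      rw [mul_add] at this
      split_ifs <;> omega
    · rw [hb]; split_ifs <;> omega

theorem snakeIndex_inj {a b i j k l : ℕ} (hi : i < 2 * a + 1) (hj : j < 2 * b + 1)
    (hk : k < 2 * a + 1) (hl : l < 2 * b + 1) (h : snakeIndex a b i j = snakeIndex a b k l) :
    i = k ∧ j = l := by
  have hpar : (i + j) % 2 = 1 ↔ (k + l) % 2 = 1 := by
    rw [← snakeIndex_lt_iff hi hj, ← snakeIndex_lt_iff hk hl, h]
  unfold snakeIndex at h
  simp only [hpar, add_right_inj] at h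
  have hr (i j : ℕ) (hi : i < 2 * a + 1) :
      (if j % 2 = 0 then i / 2 else 2 * a - i / 2) < 2 * a + 1 := by split_ifs <;> omega
  have hq := congrArg (· / (2 * a + 1)) h
  have hm := congrArg (· % (2 * a + 1)) h
  simp only [Nat.mul_add_div (Nat.succ_pos (2 * a)), Nat.mul_add_mod,
    Nat.div_eq_of_lt (hr _ _ hi), Nat.div_eq_of_lt (hr _ _ hk),
    Nat.mod_eq_of_lt (hr _ _ hi), Nat.mod_eq_of_lt (hr _ _ hk), add_zero] at hq hm
  split_ifs at hm <;> omega

namespace SimpleGraph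

theorem gridGraph_odd_isNeighborhoodPrime {a b s : ℕ} (hab : b = 0 ∨ 1 ≤ a)
    (hs : s ≤ (2 * a + 1) * (2 * b + 1))
    (h₁ : 1 ≤ b → (rotatedLabel ((2 * a + 1) * (2 * b + 1)) s 0 + 1).Coprime
      (rotatedLabel ((2 * a + 1) * (2 * b + 1)) s (2 * a) + 1))
    (h₂ : 1 ≤ b → (rotatedLabel ((2 * a + 1) * (2 * b + 1)) s ((2 * a + 1) * b + a - 1) + 1).Coprime
      (rotatedLabel ((2 * a + 1) * (2 * b + 1)) s ((2 * a + 1) * (b - 1) + a) + 1)) :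
    (gridGraph (2 * a + 1) (2 * b + 1)).IsNeighborhoodPrime := by
  set N := (2 * a + 1) * (2 * b + 1) with hN
  refine isNeighborhoodPrime_of_coprime_pair (fun v => rotatedLabel N s (snakeIndex a b v.1 v.2))
    (fun v => ?_) (fun u v huv => ?_) ?_
  · simpa using rotatedLabel_lt hs (snakeIndex_lt v.1.2 v.2.2)
  · have := snakeIndex_inj u.1.2 u.2.2 v.1.2 v.2.2 (rotatedLabel_injOn hs
      (snakeIndex_lt u.1.2 u.2.2) (snakeIndex_lt v.1.2 v.2.2) huv)
    exact Prod.ext (Fin.ext this.1) (Fin.ext this.2)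
  rintro ⟨⟨i, hi⟩, ⟨j, hj⟩⟩ ⟨⟨i₁, hi₁⟩, ⟨j₁, hj₁⟩⟩ ⟨⟨i₂, hi₂⟩, ⟨j₂, hj₂⟩⟩ hu hw huw
  simp only [gridGraph_adj, ne_eq, Prod.mk.injEq, Fin.mk.injEq] at hu hw huw
  have of_succ (k l p q : ℕ) (hk : k < 2 * a + 1) (hl : l < 2 * b + 1) (hp : p < 2 * a + 1)
      (hq : q < 2 * b + 1)
      (hkl : (i + 1 = k ∨ k + 1 = i) ∧ j = l ∨ (j + 1 = l ∨ l + 1 = j) ∧ i = k)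
      (hpq : (i + 1 = p ∨ p + 1 = i) ∧ j = q ∨ (j + 1 = q ∨ q + 1 = j) ∧ i = p)
      (h : snakeIndex a b p q = snakeIndex a b k l + 1) :
      ∃ x y : Fin (2 * a + 1) × Fin (2 * b + 1),
        (gridGraph (2 * a + 1) (2 * b + 1)).Adj (⟨i, hi⟩, ⟨j, hj⟩) x ∧
        (gridGraph (2 * a + 1) (2 * b + 1)).Adj (⟨i, hi⟩, ⟨j, hj⟩) y ∧
        (rotatedLabel N s (snakeIndex a b x.1 x.2) + 1).Coprime
          (rotatedLabel N s (snakeIndex a b y.1 y.2) + 1) := by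
    refine ⟨(⟨k, hk⟩, ⟨l, hl⟩), (⟨p, hp⟩, ⟨q, hq⟩), gridGraph_adj.2 hkl, gridGraph_adj.2 hpq, ?_⟩
    simp only [h]
    exact coprime_rotatedLabel_succ ..
  by_cases hmid : 0 < i ∧ i < 2 * a
  · by_cases hj2 : j % 2 = 0
    · refine of_succ (i - 1) j (i + 1) j (by omega) hj (by omega) hj (by omega) (by omega) ?_
      unfold snakeIndex
      split_ifs <;> omega
    · refine of_succ (i + 1) j (i - 1) j (by omega) hj (by omega) hj (by omega) (by omega) ?_
      unfold snakeIndex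
      split_ifs <;> omega
  have hb : 1 ≤ b := by omega
  have ha : 1 ≤ a := by omega
  rcases (show i = 0 ∨ i = 2 * a by omega) with rfl | rfl
  · rcases Nat.even_or_odd' j with ⟨t, rfl | rfl⟩
    · have hmul := Nat.mul_succ (2 * a + 1)
      rcases t with _ | t
      · refine ⟨(⟨1, by omega⟩, ⟨0, by omega⟩), (⟨0, by omega⟩, ⟨1, by omega⟩),
          gridGraph_adj.2 (by simp), gridGraph_adj.2 (by simp), ?_⟩
        simpa [snakeIndex] using h₁ hb
      · refine of_succ 0 (2 * t + 1) 1 (2 * (t + 1)) (by omega) (by omega) (by omega) (by omega)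
          (by omega) (by omega) ?_
        unfold snakeIndex
        rw [show 2 * (t + 1) / 2 = t + 1 by omega, show (2 * t + 1) / 2 = t by omega, hmul]
        split_ifs <;> omega
    · have hmul := Nat.mul_succ (2 * a + 1)
      refine of_succ 1 (2 * t + 1) 0 (2 * t + 2) (by omega) (by omega) (by omega) (by omega)
        (by omega) (by omega) ?_
      unfold snakeIndex
      rw [show (2 * t + 2) / 2 = t + 1 by omega, show (2 * t + 1) / 2 = t by omega, hmul]
      split_ifs <;> omega
  · rcases Nat.even_or_odd' j with ⟨t, rfl | rfl⟩
    · rcases (show t < b ∨ t = b by omega) with ht | rfl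
      · refine of_succ (2 * a - 1) (2 * t) (2 * a) (2 * t + 1) (by omega) (by omega) (by omega)
          (by omega) (by omega) (by omega) ?_
        unfold snakeIndex
        rw [show 2 * t / 2 = t by omega, show (2 * t + 1) / 2 = t by omega]
        split_ifs <;> omega
      · refine ⟨(⟨2 * a - 1, by omega⟩, ⟨2 * t, by omega⟩),
          (⟨2 * a, by omega⟩, ⟨2 * t - 1, by omega⟩),
          gridGraph_adj.2 (Or.inl ⟨Or.inr (by simp only; omega), rfl⟩),
          gridGraph_adj.2 (Or.inr ⟨Or.inr (by simp only; omega), rfl⟩), ?_⟩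
        have e₁ : snakeIndex a t (2 * a - 1) (2 * t) = (2 * a + 1) * t + a - 1 := by
          unfold snakeIndex
          rw [show 2 * t / 2 = t by omega]
          split_ifs <;> omega
        have e₂ : snakeIndex a t (2 * a) (2 * t - 1) = (2 * a + 1) * (t - 1) + a := by
          unfold snakeIndex
          rw [show (2 * t - 1) / 2 = t - 1 by omega]
          split_ifs <;> omega
        simp only [e₁, e₂]
        exact h₂ hb
    · refine of_succ (2 * a) (2 * t) (2 * a - 1) (2 * t + 1) (by omega) (by omega) (by omega)
        (by omega) (by omega) (by omega) ?_
      unfold snakeIndex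
      rw [show 2 * t / 2 = t by omega, show (2 * t + 1) / 2 = t by omega]
      split_ifs <;> omega

end SimpleGraph

theorem Nat.exists_coprime_and_add_coprime {d M : ℕ} (hM : M ≠ 0) (hd : Even d) :
    ∃ x, x.Coprime M ∧ (x + d).Coprime M := by
  set P := ∏ p ∈ M.primeFactors with ¬ p ∣ d, p
  have hP {p : ℕ} (hp : p.Prime) (hpM : p ∣ M) : p ∣ P ↔ ¬ p ∣ d := by
    constructor
    · intro h
      obtain ⟨q, hq, hpq⟩ := (hp.prime.dvd_finsetProd_iff _).1 h
      simp only [Finset.mem_filter, Nat.mem_primeFactors] at hq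
      exact (Nat.prime_dvd_prime_iff_eq hp hq.1.1).1 hpq ▸ hq.2
    · intro h
      exact Finset.dvd_prod_of_mem _ (by simp [hp, hpM, hM, h])
  refine ⟨d + P, Nat.coprime_of_dvd fun p hp h hpM => ?_, Nat.coprime_of_dvd fun p hp h hpM => ?_⟩
  · by_cases hpd : p ∣ d
    · exact (hP hp hpM).1 ((Nat.dvd_add_right hpd).1 h) hpd
    · exact hpd ((Nat.dvd_add_left ((hP hp hpM).2 hpd)).1 h)
  · by_cases hpd : p ∣ d
    · exact (hP hp hpM).1 ((Nat.dvd_add_right hpd).1 ((Nat.dvd_add_left hpd).1 h)) hpd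
    · have h2 : p ∣ 2 * d := by
        rw [show d + P + d = 2 * d + P by ring] at h
        exact (Nat.dvd_add_left ((hP hp hpM).2 hpd)).1 h
      rcases hp.dvd_mul.1 h2 with h2 | h2
      · exact hpd (((Nat.prime_dvd_prime_iff_eq hp Nat.prime_two).1 h2) ▸ hd.two_dvd)
      · exact hpd h2

theorem Nat.exists_coprime_and_add_coprime_of_le {d M : ℕ} (hM : M ≠ 0) (hd : Even d) (l : ℕ) :
    ∃ x, l ≤ x ∧ x < l + M ∧ x.Coprime M ∧ (x + d).Coprime M := by
  obtain ⟨x, hx, hxd⟩ := Nat.exists_coprime_and_add_coprime hM hd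
  obtain ⟨y, hy, hyx⟩ : ∃ y, y < M ∧ l + y ≡ x [MOD M] := by
    refine ⟨(x + (M - l % M)) % M, Nat.mod_lt _ (Nat.pos_of_ne_zero hM), ?_⟩
    have hl : l + (M - l % M) = M * (l / M) + M := by
      have := Nat.mod_lt l (Nat.pos_of_ne_zero hM)
      have := Nat.div_add_mod l M
      omega
    calc l + (x + (M - l % M)) % M ≡ l + (x + (M - l % M)) [MOD M] :=
          (Nat.mod_modEq _ _).add_left _
      _ = x + M * (l / M + 1) := by rw [mul_add, mul_one, ← hl]; ring
      _ ≡ x [MOD M] := by simp [Nat.ModEq]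
  refine ⟨l + y, by omega, by omega, ?_, ?_⟩
  · rwa [Nat.Coprime, hyx.gcd_eq]
  · rwa [Nat.Coprime, (hyx.add_right d).gcd_eq]

namespace SimpleGraph

theorem gridGraph_odd_isNeighborhoodPrime_of_le {a b : ℕ} (hpar : Even (a + b)) (hab : a ≤ b)
    (ha : 1 ≤ a) : (gridGraph (2 * a + 1) (2 * b + 1)).IsNeighborhoodPrime := by
  rcases (show a = 1 ∧ b = 1 ∨ a = 2 ∧ b = 2 ∨ 3 ≤ b by grind) with ⟨rfl, rfl⟩ | ⟨rfl, rfl⟩ | hb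
  · exact gridGraph_odd_isNeighborhoodPrime (s := 1) (by simp) (by simp)
      (by norm_num [rotatedLabel]) (by norm_num [rotatedLabel])
  · exact gridGraph_odd_isNeighborhoodPrime (s := 7) (by simp) (by simp)
      (by norm_num [rotatedLabel]) (by norm_num [rotatedLabel])
  have hN : (2 * a + 1) * (2 * b + 1) = 2 * ((2 * a + 1) * b + a) + 1 := by ring
  have hK : (2 * a + 1) * (b - 1) + (2 * a + 1) = (2 * a + 1) * b := by
    rw [← Nat.mul_succ]; congr 1; omega
  have hK3 := Nat.mul_le_mul_left (2 * a + 1) hb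
  have hd : Even ((2 * a + 1) * b + a + 2) := by
    rw [show (2 * a + 1) * b + a + 2 = a + b + 2 * (a * b + 1) by ring]
    exact hpar.add (even_two_mul _)
  obtain ⟨x, hlx, hxl, hx, hxd⟩ := Nat.exists_coprime_and_add_coprime_of_le
    (show 2 * a ≠ 0 by omega) hd (2 * a + 1)
  generalize hKdef : (2 * a + 1) * b = K at *
  refine gridGraph_odd_isNeighborhoodPrime (s := K + a - x) (Or.inr ha) (by omega)
    (fun _ => ?_) (fun _ => ?_)
  · rw [hN]
    unfold rotatedLabel
    rw [if_pos (by omega), if_pos (by omega)]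
    rw [show 2 * (K + a) + 1 - (K + a - x) + 0 + 1 = x + (K + a + 2) by omega,
      show 2 * (K + a) + 1 - (K + a - x) + 2 * a + 1 = 2 * a + (x + (K + a + 2)) by omega]
    simpa using hxd
  · rw [hN, hKdef]
    unfold rotatedLabel
    rw [if_neg (by omega), if_neg (by omega)]
    obtain ⟨y, rfl⟩ : ∃ y, x = y + 2 * a := ⟨x - 2 * a, by omega⟩
    rw [show K + a - 1 - (K + a - (y + 2 * a)) + 1 = y + 2 * a by omega,
      show (2 * a + 1) * (b - 1) + a - (K + a - (y + 2 * a)) + 1 = y by omega]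
    have : y.Coprime (2 * a) := by simpa using hx
    simpa [Nat.coprime_comm] using this

theorem gridGraph_odd_isNeighborhoodPrime_of_even {a b : ℕ} (hpar : Even (a + b)) (hab : a ≤ b) :
    (gridGraph (2 * a + 1) (2 * b + 1)).IsNeighborhoodPrime := by
  rcases Nat.eq_zero_or_pos a with rfl | ha
  · exact .of_iso (boxProdComm _ _)
      (gridGraph_odd_isNeighborhoodPrime (a := b) (b := 0) (s := 0) (Or.inl rfl) (Nat.zero_le _)
        (by simp) (by simp))
  · exact gridGraph_odd_isNeighborhoodPrime_of_le hpar hab ha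

end SimpleGraph

/-- The grid graph P_m × P_n is neighborhood-prime if m ≡ 1 (mod 4) and
n ≡ 1 (mod 4), or if m ≡ 3 (mod 4) and n ≡ 3 (mod 4). -/
theorem gridGraph_one_or_three_mod_four_isNeighborhoodPrime (m n : ℕ)
    (hm : 1 ≤ m) (hn : 1 ≤ n)
    (h : (m % 4 = 1 ∧ n % 4 = 1) ∨ (m % 4 = 3 ∧ n % 4 = 3)) :
    (SimpleGraph.gridGraph m n).IsNeighborhoodPrime := by
  obtain ⟨a, rfl⟩ : ∃ a, m = 2 * a + 1 := ⟨m / 2, by omega⟩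
  obtain ⟨b, rfl⟩ : ∃ b, n = 2 * b + 1 := ⟨n / 2, by omega⟩
  have hpar : Even (a + b) := Nat.even_iff.2 (by omega)
  rcases le_total a b with hab | hab
  · exact SimpleGraph.gridGraph_odd_isNeighborhoodPrime_of_even hpar hab
  · exact .of_iso (SimpleGraph.boxProdComm _ _)
      (SimpleGraph.gridGraph_odd_isNeighborhoodPrime_of_even (add_comm a b ▸ hpar) hab)
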